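/- Let k ≥ 0 be an integer and assume σ ≥ k + 3/2. Then there exists a constant C > 0 depending only on σ, β and k (independent of ε, N and φ) such that Σ_{i=1}^{N/4} Σ_{j=1}^{N/4} min{(h_i/√ε)^{2(k+1)} + (h_j/√ε)^{2(k+1)}, 1} · e^{−2β(x_{i−1} + x_{j−1})/√ε} · min{h_i/√ε, 1} · min{h_j/√ε, 1} ≤ C · (N⁻¹ · sup_{t∈[0,1/4]} |ψ′(t)|)^{2(k+1)}. -/

import Mathlib

/-- A layer-adapted mesh for a singularly perturbed reaction–diffusion problem,
with parameters `β, σ > 0`, number of elements `N` (a multiple of 4, `N ≥ 4`),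
perturbation parameter `ε` with `√ε ≤ N⁻¹`, and mesh-generating function `φ`
(with derivative `φ'` on `[0, 1/4]`). -/
structure LayerMesh (β σ : ℝ) (N : ℕ) (ε : ℝ) (φ φ' : ℝ → ℝ) where
  hβ : 0 < β
  hσ : 0 < σ
  hN : 4 ≤ N
  hN4 : N % 4 = 0
  hε : 0 < ε
  hεN : Real.sqrt ε ≤ (N : ℝ)⁻¹
  hderiv : ∀ t ∈ Set.Icc (0:ℝ) (1/4), HasDerivWithinAt φ (φ' t) (Set.Icc (0:ℝ) (1/4)) t
  hcont : ContinuousOn φ' (Set.Icc (0:ℝ) (1/4))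
  hφ0 : φ 0 = 0
  hφ'pos : ∀ t ∈ Set.Icc (0:ℝ) (1/4), 0 < φ' t
  hφ'mono : ∀ s ∈ Set.Icc (0:ℝ) (1/4), ∀ t ∈ Set.Icc (0:ℝ) (1/4), s ≤ t → φ' s ≤ φ' t
  hτ : σ * Real.sqrt ε / β * φ (1/4) ≤ 1/4
  x : ℕ → ℝ
  hx_left : ∀ i : ℕ, i ≤ N / 4 → x i = σ * Real.sqrt ε / β * φ ((i : ℝ) / (N : ℝ))
  hx_mid : ∀ i : ℕ, N / 4 < i → i < 3 * N / 4 →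
    x i = σ * Real.sqrt ε / β * φ (1/4)
      + 2 * (1 - 2 * (σ * Real.sqrt ε / β * φ (1/4))) * ((i : ℝ) / (N : ℝ) - 1/4)
  hx_right : ∀ i : ℕ, 3 * N / 4 ≤ i → i ≤ N →
    x i = 1 - σ * Real.sqrt ε / β * φ (1 - (i : ℝ) / (N : ℝ))

namespace LayerMesh

variable {β σ ε : ℝ} {N : ℕ} {φ φ' : ℝ → ℝ}

/-- The mesh width `h_i = x_i − x_{i−1}`. -/
noncomputable def h (M : LayerMesh β σ N ε φ φ') (i : ℕ) : ℝ := M.x i - M.x (i - 1)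

/-- The quantity `Θ_i = min{h_i/√ε, 1} · e^{−β x_{i−1}/(σ√ε)}`, for `1 ≤ i ≤ N/4`. -/
noncomputable def Θ (M : LayerMesh β σ N ε φ φ') (i : ℕ) : ℝ :=
  min (M.h i / Real.sqrt ε) 1 * Real.exp (-(β * M.x (i - 1)) / (σ * Real.sqrt ε))

end LayerMesh

/-- `sup_{t ∈ [0,1/4]} |ψ'(t)|` where `ψ = e^{−φ}`, so `ψ' = −φ'·e^{−φ}`. -/
noncomputable def psiSup (φ φ' : ℝ → ℝ) : ℝ :=
  sSup ((fun t => |(-(φ' t)) * Real.exp (-(φ t))|) '' Set.Icc (0:ℝ) (1/4))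

/-- If the elements of a partition carry weights `E i`, local sizes `a i`, and masses `w i` of total
at most one, each at most `B`, then the tensor-product sum of the saturated errors is of order
`B ^ n`. -/
theorem double_sum_min_le {ι : Type*} (s : Finset ι) (a E w : ι → ℝ) (K B : ℝ) (n : ℕ)
    (hK : 0 ≤ K) (hs : s.Nonempty) (ha : ∀ i ∈ s, 0 ≤ a i) (hE : ∀ i ∈ s, 0 ≤ E i)
    (hw : ∀ i ∈ s, 0 ≤ w i)
    (hwB : ∀ i ∈ s, w i ≤ B) (hsum : ∑ i ∈ s, w i ≤ 1)
    (h_one : ∀ i ∈ s, min (a i) 1 * E i ≤ K * w i)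
    (h_pow : ∀ i ∈ s, min (a i) 1 ^ (n + 1) * E i ≤ (K * w i) ^ (n + 1)) :
    ∑ i ∈ s, ∑ j ∈ s, min (a i ^ n + a j ^ n) 1 * (E i * E j) * min (a i) 1 * min (a j) 1
      ≤ 2 * K ^ (n + 2) * B ^ n := by
  have hμ : ∀ i ∈ s, 0 ≤ min (a i) 1 := fun i hi => le_min (ha i hi) zero_le_one
  have hmin : ∀ i ∈ s, ∀ j ∈ s,
      min (a i ^ n + a j ^ n) 1 ≤ min (a i) 1 ^ n + min (a j) 1 ^ n := by
    intro i hi j hj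
    rcases le_total (a i) 1 with h | h
    · rcases le_total (a j) 1 with h' | h'
      · rw [min_eq_left h, min_eq_left h']
        exact min_le_left _ _
      · rw [min_eq_right h', one_pow]
        exact (min_le_right _ _).trans (le_add_of_nonneg_left (pow_nonneg (hμ i hi) n))
    · rw [min_eq_right h, one_pow]
      exact (min_le_right _ _).trans (le_add_of_nonneg_right (pow_nonneg (hμ j hj) n))
  have h_low : ∑ i ∈ s, min (a i) 1 * E i ≤ K :=
    calc ∑ i ∈ s, min (a i) 1 * E i ≤ ∑ i ∈ s, K * w i := Finset.sum_le_sum h_one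
      _ = K * ∑ i ∈ s, w i := by rw [Finset.mul_sum]
      _ ≤ K := mul_le_of_le_one_right hK hsum
  have h_low0 : 0 ≤ ∑ i ∈ s, min (a i) 1 * E i :=
    Finset.sum_nonneg fun i hi => mul_nonneg (hμ i hi) (hE i hi)
  have h_high : ∑ i ∈ s, min (a i) 1 ^ (n + 1) * E i ≤ K ^ (n + 1) * B ^ n := by
    obtain ⟨i₀, hi₀⟩ := hs
    have hB : 0 ≤ B := (hw i₀ hi₀).trans (hwB i₀ hi₀)
    calc ∑ i ∈ s, min (a i) 1 ^ (n + 1) * E i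
        ≤ ∑ i ∈ s, K ^ (n + 1) * B ^ n * w i := by
          refine Finset.sum_le_sum fun i hi => (h_pow i hi).trans ?_
          rw [mul_pow, pow_succ (w i), ← mul_assoc]
          have := hw i hi
          have := hwB i hi
          gcongr
      _ = K ^ (n + 1) * B ^ n * ∑ i ∈ s, w i := by rw [Finset.mul_sum]
      _ ≤ K ^ (n + 1) * B ^ n := mul_le_of_le_one_right (by positivity) hsum
  calc ∑ i ∈ s, ∑ j ∈ s, min (a i ^ n + a j ^ n) 1 * (E i * E j) * min (a i) 1 * min (a j) 1
      ≤ ∑ i ∈ s, ∑ j ∈ s, ((min (a i) 1 ^ (n + 1) * E i) * (min (a j) 1 * E j)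
          + (min (a i) 1 * E i) * (min (a j) 1 ^ (n + 1) * E j)) := by
        refine Finset.sum_le_sum fun i hi => Finset.sum_le_sum fun j hj => ?_
        have h0 : 0 ≤ E i * E j * min (a i) 1 * min (a j) 1 :=
          mul_nonneg (mul_nonneg (mul_nonneg (hE i hi) (hE j hj)) (hμ i hi)) (hμ j hj)
        calc min (a i ^ n + a j ^ n) 1 * (E i * E j) * min (a i) 1 * min (a j) 1
            = min (a i ^ n + a j ^ n) 1 * (E i * E j * min (a i) 1 * min (a j) 1) := by ring
          _ ≤ (min (a i) 1 ^ n + min (a j) 1 ^ n) * (E i * E j * min (a i) 1 * min (a j) 1) :=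
            mul_le_mul_of_nonneg_right (hmin i hi j hj) h0
          _ = _ := by ring
    _ = 2 * ((∑ i ∈ s, min (a i) 1 ^ (n + 1) * E i) * ∑ i ∈ s, min (a i) 1 * E i) := by
        simp only [Finset.sum_add_distrib, ← Finset.mul_sum, ← Finset.sum_mul]
        ring
    _ ≤ 2 * (K ^ (n + 1) * B ^ n * K) := by
        have hX : 0 ≤ ∑ i ∈ s, min (a i) 1 ^ (n + 1) * E i :=
          Finset.sum_nonneg fun i hi => mul_nonneg (pow_nonneg (hμ i hi) _) (hE i hi)
        exact mul_le_mul_of_nonneg_left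
          (mul_le_mul h_high h_low h_low0 (hX.trans h_high)) zero_le_two
    _ = 2 * K ^ (n + 2) * B ^ n := by ring

/-- A rescaled saturated increment is controlled by `1 - exp (-d)`. -/
theorem min_mul_one_le_mul_one_sub_exp_neg {c d : ℝ} (hc : 0 ≤ c) (hd : 0 ≤ d) :
    min (c * d) 1 ≤ 2 * (c + 1) * (1 - Real.exp (-d)) := by
  have hexp : Real.exp (-d) ≤ (1 + d)⁻¹ := by
    rw [Real.exp_neg]
    exact inv_anti₀ (by linarith) (by linarith [Real.add_one_le_exp d])
  have hfrac : d / (1 + d) ≤ 1 - Real.exp (-d) := by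
    have : d / (1 + d) = 1 - (1 + d)⁻¹ := by field_simp; ring
    linarith
  refine le_trans ?_ (mul_le_mul_of_nonneg_left hfrac (by positivity))
  rw [← mul_div_assoc, le_div_iff₀ (by linarith)]
  rcases le_total d 1 with h | h
  · have : min (c * d) 1 * (1 + d) ≤ c * d * 2 :=
      mul_le_mul (min_le_left _ _) (by linarith) (by linarith) (by positivity)
    linarith
  · have : min (c * d) 1 * (1 + d) ≤ 1 * (1 + d) :=
      mul_le_mul_of_nonneg_right (min_le_right _ _) (by linarith)
    nlinarith [mul_nonneg hc hd]

namespace LayerMesh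

variable {β σ ε : ℝ} {N : ℕ} {φ φ' : ℝ → ℝ}

theorem continuousOn_φ (M : LayerMesh β σ N ε φ φ') : ContinuousOn φ (Set.Icc (0:ℝ) (1/4)) :=
  fun t ht => (M.hderiv t ht).continuousWithinAt

theorem monotoneOn_φ (M : LayerMesh β σ N ε φ φ') : MonotoneOn φ (Set.Icc (0:ℝ) (1/4)) :=
  monotoneOn_of_hasDerivWithinAt_nonneg (convex_Icc _ _) M.continuousOn_φ
    (fun t ht => (M.hderiv t (interior_subset ht)).mono interior_subset)
    fun t ht => (M.hφ'pos t (interior_subset ht)).le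

theorem abs_deriv_exp_neg_le_psiSup (M : LayerMesh β σ N ε φ φ') {t : ℝ}
    (ht : t ∈ Set.Icc (0:ℝ) (1/4)) : |(-(φ' t)) * Real.exp (-(φ t))| ≤ psiSup φ φ' :=
  le_csSup (isCompact_Icc.image_of_continuousOn
    (M.hcont.neg.mul M.continuousOn_φ.neg.rexp).abs).bddAbove (Set.mem_image_of_mem _ ht)

theorem exp_neg_sub_le (M : LayerMesh β σ N ε φ φ') {s t : ℝ} (hs : s ∈ Set.Icc (0:ℝ) (1/4))
    (ht : t ∈ Set.Icc (0:ℝ) (1/4)) (hst : s ≤ t) :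
    Real.exp (-(φ s)) - Real.exp (-(φ t)) ≤ (t - s) * psiSup φ φ' := by
  have h := (convex_Icc (0:ℝ) (1/4)).norm_image_sub_le_of_norm_hasDerivWithin_le
    (f := fun t => Real.exp (-(φ t))) (f' := fun t => Real.exp (-(φ t)) * -(φ' t))
    (C := psiSup φ φ') (fun t ht => (M.hderiv t ht).fun_neg.exp)
    (fun t ht => by
      rw [mul_comm]
      exact M.abs_deriv_exp_neg_le_psiSup ht) ht hs
  rw [Real.norm_eq_abs, Real.norm_eq_abs, abs_sub_comm s t, abs_of_nonneg (sub_nonneg.2 hst)] at h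
  linarith [le_abs_self (Real.exp (-(φ s)) - Real.exp (-(φ t)))]

theorem node_mem (N : ℕ) {i : ℕ} (hi : i ≤ N / 4) :
    (i : ℝ) / (N : ℝ) ∈ Set.Icc (0:ℝ) (1/4) := by
  refine ⟨by positivity, div_le_of_le_mul₀ (by positivity) (by positivity) ?_⟩
  have h : ((4 * i : ℕ) : ℝ) ≤ N := Nat.cast_le.2 (by omega)
  push_cast at h
  linarith

end LayerMesh

theorem stmt16 (β σ : ℝ) (k : ℕ) (hβ : 0 < β) (hσ : 0 < σ)
    (hσk : (k : ℝ) + 3/2 ≤ σ) :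
    ∃ C : ℝ, 0 < C ∧
      ∀ (N : ℕ) (ε : ℝ) (φ φ' : ℝ → ℝ) (M : LayerMesh β σ N ε φ φ'),
        ∑ i ∈ Finset.Icc 1 (N / 4), ∑ j ∈ Finset.Icc 1 (N / 4),
            min ((M.h i / Real.sqrt ε) ^ (2 * (k + 1))
                  + (M.h j / Real.sqrt ε) ^ (2 * (k + 1))) 1
              * Real.exp (-(2 * β * (M.x (i - 1) + M.x (j - 1))) / Real.sqrt ε)
              * min (M.h i / Real.sqrt ε) 1 * min (M.h j / Real.sqrt ε) 1
          ≤ C * ((N : ℝ)⁻¹ * psiSup φ φ') ^ (2 * (k + 1)) := by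
  refine ⟨2 * (2 * (σ / β + 1)) ^ (2 * (k + 1) + 2), by positivity, fun N ε φ φ' M => ?_⟩
  set K := 2 * (σ / β + 1)
  have hK : 0 ≤ K := by positivity
  have hε : 0 < Real.sqrt ε := Real.sqrt_pos.2 M.hε
  have hN : (0:ℝ) < N := Nat.cast_pos.2 (by linarith [M.hN])
  let ψ : ℕ → ℝ := fun i => Real.exp (-(φ ((i : ℝ) / N)))
  let w : ℕ → ℝ := fun i => ψ (i - 1) - ψ i
  let E : ℕ → ℝ := fun i => Real.exp (-(2 * β * M.x (i - 1)) / Real.sqrt ε)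
  have hstep : ∀ i ∈ Finset.Icc 1 (N / 4), ((i - 1 : ℕ) : ℝ) / N = i / N - (N : ℝ)⁻¹ := by
    intro i hi
    rw [Nat.cast_sub (Finset.mem_Icc.1 hi).1]
    push_cast
    ring
  have hmem : ∀ i ∈ Finset.Icc 1 (N / 4), (i : ℝ) / N ∈ Set.Icc (0:ℝ) (1/4) := fun i hi =>
    LayerMesh.node_mem N (Finset.mem_Icc.1 hi).2
  have hmem' : ∀ i ∈ Finset.Icc 1 (N / 4), ((i - 1 : ℕ) : ℝ) / N ∈ Set.Icc (0:ℝ) (1/4) :=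
    fun i hi => LayerMesh.node_mem N ((Nat.sub_le _ _).trans (Finset.mem_Icc.1 hi).2)
  have hle : ∀ i ∈ Finset.Icc 1 (N / 4), ((i - 1 : ℕ) : ℝ) / N ≤ i / N := fun i hi => by
    rw [hstep i hi]
    linarith [inv_pos.2 hN]
  have hφle : ∀ i ∈ Finset.Icc 1 (N / 4), φ (((i - 1 : ℕ) : ℝ) / N) ≤ φ (i / N) := fun i hi =>
    M.monotoneOn_φ (hmem' i hi) (hmem i hi) (hle i hi)
  have hφ0 : ∀ i ∈ Finset.Icc 1 (N / 4), 0 ≤ φ (((i - 1 : ℕ) : ℝ) / N) := fun i hi =>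
    M.hφ0 ▸ M.monotoneOn_φ ⟨le_rfl, by norm_num⟩ (hmem' i hi) (hmem' i hi).1
  have ha : ∀ i ∈ Finset.Icc 1 (N / 4), M.h i / Real.sqrt ε =
      σ / β * (φ (i / N) - φ (((i - 1 : ℕ) : ℝ) / N)) := by
    intro i hi
    have h := (Finset.mem_Icc.1 hi).2
    rw [LayerMesh.h, M.hx_left i h, M.hx_left (i - 1) ((Nat.sub_le _ _).trans h)]
    field_simp
  have ha0 : ∀ i ∈ Finset.Icc 1 (N / 4), 0 ≤ M.h i / Real.sqrt ε := fun i hi => by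
    rw [ha i hi]
    exact mul_nonneg (by positivity) (sub_nonneg.2 (hφle i hi))
  have hEψ : ∀ i ∈ Finset.Icc 1 (N / 4), E i = Real.exp (2 * σ * -(φ (((i - 1 : ℕ) : ℝ) / N))) := by
    intro i hi
    simp only [E]
    rw [M.hx_left (i - 1) ((Nat.sub_le _ _).trans (Finset.mem_Icc.1 hi).2)]
    congr 1
    field_simp
  have hw : ∀ i ∈ Finset.Icc 1 (N / 4), w i =
      (1 - Real.exp (-(φ (i / N) - φ (((i - 1 : ℕ) : ℝ) / N)))) * ψ (i - 1) := by
    intro i hi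
    simp only [w, ψ]
    rw [sub_mul, one_mul, ← Real.exp_add]
    ring_nf
  have hKw : ∀ i ∈ Finset.Icc 1 (N / 4), min (M.h i / Real.sqrt ε) 1 * ψ (i - 1) ≤ K * w i := by
    intro i hi
    rw [hw i hi, ha i hi, ← mul_assoc]
    exact mul_le_mul_of_nonneg_right (min_mul_one_le_mul_one_sub_exp_neg (by positivity)
      (sub_nonneg.2 (hφle i hi))) (Real.exp_nonneg _)
  have hEpow : ∀ n : ℕ, (n : ℝ) ≤ 2 * σ → ∀ i ∈ Finset.Icc 1 (N / 4), E i ≤ ψ (i - 1) ^ n := by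
    intro n hn i hi
    rw [hEψ i hi, ← Real.exp_nat_mul]
    exact Real.exp_le_exp.2 (mul_le_mul_of_nonpos_right hn (neg_nonpos.2 (hφ0 i hi)))
  have hμE : ∀ n : ℕ, (n : ℝ) ≤ 2 * σ → ∀ i ∈ Finset.Icc 1 (N / 4),
      min (M.h i / Real.sqrt ε) 1 ^ n * E i ≤ (K * w i) ^ n := by
    intro n hn i hi
    have hμ : 0 ≤ min (M.h i / Real.sqrt ε) 1 := le_min (ha0 i hi) zero_le_one
    calc min (M.h i / Real.sqrt ε) 1 ^ n * E i
        ≤ min (M.h i / Real.sqrt ε) 1 ^ n * ψ (i - 1) ^ n :=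
          mul_le_mul_of_nonneg_left (hEpow n hn i hi) (pow_nonneg hμ n)
      _ = (min (M.h i / Real.sqrt ε) 1 * ψ (i - 1)) ^ n := (mul_pow _ _ _).symm
      _ ≤ (K * w i) ^ n :=
          pow_le_pow_left₀ (mul_nonneg hμ (Real.exp_nonneg _)) (hKw i hi) n
  have hsum : ∑ i ∈ Finset.Icc 1 (N / 4), w i ≤ 1 := by
    have htel : ∑ i ∈ Finset.Icc 1 (N / 4), w i = ψ 0 - ψ (N / 4) := by
      rw [← Finset.sum_range_sub' ψ, ← Finset.Ico_add_one_right_eq_Icc, Finset.sum_Ico_eq_sum_range]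
      refine Finset.sum_congr (by simp) fun i _ => ?_
      simp [w, add_comm]
    have h0 : ψ 0 = 1 := by simp [ψ, M.hφ0]
    rw [htel, h0]
    exact sub_le_self _ (Real.exp_nonneg _)
  have hmain := double_sum_min_le (Finset.Icc 1 (N / 4)) (fun i => M.h i / Real.sqrt ε) E w K
    ((N : ℝ)⁻¹ * psiSup φ φ') (2 * (k + 1)) hK
    ⟨N / 4, Finset.mem_Icc.2 ⟨by have := M.hN; omega, le_rfl⟩⟩ ha0
    (fun i _ => Real.exp_nonneg _)
    (fun i hi => sub_nonneg.2 (Real.exp_le_exp.2 (neg_le_neg (hφle i hi))))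
    (fun i hi => by
      have h := M.exp_neg_sub_le (hmem' i hi) (hmem i hi) (hle i hi)
      rwa [show (i : ℝ) / N - ((i - 1 : ℕ) : ℝ) / N = (N : ℝ)⁻¹ by rw [hstep i hi]; ring] at h)
    hsum
    (fun i hi => by
      simpa using hμE 1 (by push_cast; linarith [Nat.cast_nonneg (α := ℝ) k]) i hi)
    (hμE (2 * (k + 1) + 1) (by push_cast; linarith))
  refine le_of_eq_of_le (Finset.sum_congr rfl fun i _ => Finset.sum_congr rfl fun j _ => ?_) hmain
  simp only [E]
  rw [← Real.exp_add]
  ring_nf
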